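/- Let X be a finite poset. Assume there exist a maximal connected subset Y of X (maximal in C(X) under inclusion), elements a, b, c, d ∈ Y and n ≥ 1 satisfying: (i) the subposet Y satisfies condition (*_{n−1}); (ii) |min_Y(a) ∪ min_Y(b)| = n; (iii) min_Y(a) ⊄ min_Y(b) and min_Y(b) ⊄ min_Y(a); (iv) min_Y(c) = min_Y(d) = min_Y(a) ∪ min_Y(b); (v) a ≤ c, a ≤ d, b ≤ c, b ≤ d; (vi) there is no e ∈ Y with a ≤ e, b ≤ e, e ≤ c and e ≤ d. Then the preordered class Un(X) of unifiers for X admits no minimal complete set (type 0). -/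

import Mathlib

/-- The set of minimal elements of a poset `X` lying below `x`. -/
def minBelow (X : Type*) [PartialOrder X] (x : X) : Set X :=
  {m | m ≤ x ∧ ∀ z : X, z ≤ m → z = m}

/-- A p-morphism between posets: a monotone map commuting with `minBelow`. -/
def IsPMorphism {X Y : Type*} [PartialOrder X] [PartialOrder Y] (u : X → Y) : Prop :=
  Monotone u ∧ ∀ x : X, u '' minBelow X x = minBelow Y (u x)

/-- Condition `(*)`. -/
def StarCond (X : Type*) [PartialOrder X] : Prop :=
  ∀ x y : X, ∃ z : X, IsLUB {x, y} z ∧ minBelow X z = minBelow X x ∪ minBelow X y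

/-- Condition `(*_n)` for `n ≥ 1`. -/
def StarCondN (n : ℕ) (X : Type*) [PartialOrder X] : Prop :=
  ∀ x y : X, (minBelow X x ∪ minBelow X y).ncard ≤ n →
    ∃ z : X, IsLUB {x, y} z ∧ minBelow X z = minBelow X x ∪ minBelow X y

/-- Condition `(*_n)` with the convention that `(*_0)` means nonempty. -/
def StarCondN' (n : ℕ) (X : Type*) [PartialOrder X] : Prop :=
  if n = 0 then Nonempty X else StarCondN n X

/-- The poset `X` belongs to the class `P^f_n`. -/
def InPfn (n : ℕ) (X : Type*) [PartialOrder X] : Prop :=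
  ∀ x : X, (minBelow X x).ncard ≤ n

/-- `M` is a complete set for the preordered class `(S, le)`. -/
def IsCompleteSet {S : Type*} (le : S → S → Prop) (M : Set S) : Prop :=
  ∀ x : S, ∃ y ∈ M, le x y

/-- `M` is a minimal complete set for the preordered class `(S, le)`. -/
def IsMinimalCompleteSet {S : Type*} (le : S → S → Prop) (M : Set S) : Prop :=
  IsCompleteSet le M ∧ ∀ x ∈ M, ∀ y ∈ M, le x y → x = y

/-- A connected subset of a poset. -/
def IsConnectedSub (X : Type*) [PartialOrder X] (Y : Set X) : Prop :=
  (∀ y ∈ Y, minBelow X y ⊆ Y) ∧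
  ∀ x ∈ Y, ∀ y ∈ Y, ∃ z ∈ Y, x ≤ z ∧ y ≤ z ∧
    minBelow X z = minBelow X x ∪ minBelow X y

/-- An `n`-connected subset of a poset. -/
def IsNConnectedSub (n : ℕ) (X : Type*) [PartialOrder X] (Y : Set X) : Prop :=
  (∀ y ∈ Y, minBelow X y ⊆ Y) ∧
  (∀ S : Set X, S ⊆ (⋃ y ∈ Y, minBelow X y) → S.Nonempty → S.ncard ≤ n →
    ∃ z ∈ Y, minBelow X z = S) ∧
  (∀ x ∈ Y, ∀ y ∈ Y, minBelow X x = minBelow X y → (minBelow X x).ncard < n →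
    ∃ (r : ℕ) (c : ℕ → X), c 0 = x ∧ c r = y ∧ (∀ i ≤ r, c i ∈ Y) ∧
      (∀ i ≤ r, minBelow X (c i) = minBelow X x) ∧
      (∀ i < r, if Even i then c (i + 1) ≤ c i else c i ≤ c (i + 1)))

/-- The special product `X ⊙ Y`. -/
abbrev Odot (X Y : Type*) : Type _ :=
  {p : WithBot X × WithBot Y // p ≠ (⊥, ⊥)}

/-- The subposet `(X)_n` of elements with at most `n` minimal elements below them. -/
abbrev SubPn (n : ℕ) (X : Type*) [PartialOrder X] : Type _ :=
  {x : X // (minBelow X x).ncard ≤ n}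

/-- A unifier for a finite poset `X`: a p-morphism into `X` from a nonempty finite
poset satisfying `(*)`. -/
structure Unifier (X : Type) [PartialOrder X] [Finite X] : Type 1 where
  Y : Type
  [po : PartialOrder Y]
  [fin : Finite Y]
  ne : Nonempty Y
  star : StarCond Y
  u : Y → X
  hu : IsPMorphism u

attribute [instance] Unifier.po Unifier.fin

/-- The "more general" preorder on unifiers: `v ≼ w`. -/
def UnifierLE {X : Type} [PartialOrder X] [Finite X] (v w : Unifier X) : Prop :=
  ∃ ψ : v.Y → w.Y, IsPMorphism ψ ∧ w.u ∘ ψ = v.u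

/-- An `n`-unifier for a finite poset `X` in `P^f_n`. -/
structure UnifierN (n : ℕ) (X : Type) [PartialOrder X] [Finite X] : Type 1 where
  Y : Type
  [po : PartialOrder Y]
  [fin : Finite Y]
  ne : Nonempty Y
  mem : InPfn n Y
  star : StarCondN n Y
  u : Y → X
  hu : IsPMorphism u

attribute [instance] UnifierN.po UnifierN.fin

/-- The "more general" preorder on `n`-unifiers: `v ≼ w`. -/
def UnifierNLE {n : ℕ} {X : Type} [PartialOrder X] [Finite X] (v w : UnifierN n X) : Prop :=
  ∃ ψ : v.Y → w.Y, IsPMorphism ψ ∧ w.u ∘ ψ = v.u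

lemma isLUB_pair_of_le {α : Type*} [Preorder α] {x y : α} (h : x ≤ y) : IsLUB {x, y} y :=
  ⟨by rintro _ (rfl | rfl); exacts [h, le_rfl], fun _ hz => hz (Set.mem_insert_of_mem _ rfl)⟩

lemma minBelow_subset_of_le {X : Type*} [PartialOrder X] {x y : X} (h : x ≤ y) :
    minBelow X x ⊆ minBelow X y :=
  fun _ hm => ⟨hm.1.trans h, hm.2⟩

lemma minBelow_eq_singleton {X : Type*} [PartialOrder X] {m : X} (h : ∀ z : X, z ≤ m → z = m) :
    minBelow X m = {m} := by
  ext z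
  exact ⟨fun hz => h z hz.1, fun hz => by rw [Set.mem_singleton_iff.1 hz]; exact ⟨le_rfl, h⟩⟩

lemma minBelow_nonempty {X : Type*} [PartialOrder X] [Finite X] (x : X) :
    (minBelow X x).Nonempty := by
  obtain ⟨m, hm, hmin⟩ := Set.Finite.exists_le_minimal (Set.toFinite (Set.Iic x))
    (Set.mem_Iic.2 (le_refl x))
  exact ⟨m, hmin.1, fun z hz => le_antisymm hz (hmin.2 (hz.trans hmin.1) hz)⟩

/-- A finite nonempty subset of a connected set has an upper bound with the expected minimal
elements. -/
lemma IsConnectedSub.exists_upperBound {X : Type*} [PartialOrder X] {Z : Set X}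
    (hZ : IsConnectedSub X Z) {T : Set X} (hT : T.Finite) (hne : T.Nonempty) (hTZ : T ⊆ Z) :
    ∃ z ∈ Z, (∀ t ∈ T, t ≤ z) ∧ minBelow X z = ⋃ t ∈ T, minBelow X t := by
  induction T, hT using Set.Finite.induction_on with
  | empty => exact absurd hne Set.not_nonempty_empty
  | @insert t s _ _ ih =>
    rw [Set.insert_subset_iff] at hTZ
    rcases s.eq_empty_or_nonempty with rfl | hs
    · exact ⟨t, hTZ.1, by simp, by simp⟩
    · obtain ⟨z, hz, hle, hmin⟩ := ih hs hTZ.2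
      obtain ⟨r, hr, h1, h2, h3⟩ := hZ.2 t hTZ.1 z hz
      refine ⟨r, hr, ?_, ?_⟩
      · rintro y (rfl | hy)
        exacts [h1, (hle y hy).trans h2]
      · rw [h3, hmin, Set.biUnion_insert]

lemma IsConnectedSub.image_minBelow {X : Type*} [PartialOrder X] [Finite X] {Y : Set X}
    (hY : IsConnectedSub X Y) (y : {y : X // y ∈ Y}) :
    Subtype.val '' minBelow {y : X // y ∈ Y} y = minBelow X y := by
  ext m
  constructor
  · rintro ⟨m, ⟨hm, hmin⟩, rfl⟩
    refine ⟨hm, fun z hz => ?_⟩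
    obtain ⟨r, hr⟩ := minBelow_nonempty z
    have hrm : r ∈ minBelow X (m : X) := minBelow_subset_of_le hz hr
    have := congrArg Subtype.val (hmin ⟨r, hY.1 m m.2 hrm⟩ hrm.1)
    exact le_antisymm hz (this.symm.le.trans hr.1)
  · intro hm
    exact ⟨⟨m, hY.1 y y.2 hm⟩, ⟨hm.1, fun z hz => Subtype.ext (hm.2 z hz)⟩, rfl⟩

/-- In a connected set satisfying `(*_k)`, finite sets lying over at most `k` minimal elements
have least upper bounds. -/
lemma IsConnectedSub.exists_lub {X : Type*} [PartialOrder X] [Finite X] {Y : Set X}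
    (hY : IsConnectedSub X Y) {k : ℕ} (hk : StarCondN k {y : X // y ∈ Y})
    {T : Set X} (hT : T.Finite) (hne : T.Nonempty) (hTY : T ⊆ Y)
    (hcard : (⋃ t ∈ T, minBelow X t).ncard ≤ k) :
    ∃ z ∈ Y, (∀ t ∈ T, t ≤ z) ∧ (∀ y ∈ Y, (∀ t ∈ T, t ≤ y) → z ≤ y) ∧
      minBelow X z = ⋃ t ∈ T, minBelow X t := by
  induction T, hT using Set.Finite.induction_on with
  | empty => exact absurd hne Set.not_nonempty_empty
  | @insert t s _ _ ih =>
    rw [Set.insert_subset_iff] at hTY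
    rcases s.eq_empty_or_nonempty with rfl | hs
    · exact ⟨t, hTY.1, by simp, by simp, by simp⟩
    · rw [Set.biUnion_insert] at hcard
      obtain ⟨z, hz, hle, hlub, hmin⟩ := ih hs hTY.2
        ((Set.ncard_le_ncard Set.subset_union_right (Set.toFinite _)).trans hcard)
      obtain ⟨r, hr, h3⟩ := hk ⟨t, hTY.1⟩ ⟨z, hz⟩ (by
        rw [← Set.ncard_image_of_injective _ Subtype.val_injective, Set.image_union,
          hY.image_minBelow, hY.image_minBelow]
        simpa only [hmin] using hcard)
      have h1 : t ≤ r := hr.1 (Set.mem_insert _ _)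
      have h2 : z ≤ r := hr.1 (Set.mem_insert_of_mem _ rfl)
      refine ⟨r, r.2, ?_, ?_, ?_⟩
      · rintro y (rfl | hy)
        exacts [h1, (hle y hy).trans h2]
      · intro y hy hub
        refine hr.2 (show (⟨y, hy⟩ : {y : X // y ∈ Y}) ∈ _ from ?_)
        rintro x (rfl | rfl)
        · exact hub t (Set.mem_insert _ _)
        · exact hlub y hy fun t ht => hub t (Set.mem_insert_of_mem _ ht)
      · rw [← hY.image_minBelow, h3, Set.image_union, hY.image_minBelow, hY.image_minBelow, hmin,
          Set.biUnion_insert]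

/-- A p-morphism into a connected set, defined on a lower set containing all minimal elements,
extends to the whole poset. -/
lemma exists_pMorphism_extension {P X : Type*} [PartialOrder P] [Finite P] [PartialOrder X]
    {Z : Set X} (hZ : IsConnectedSub X Z) (I : Set P) (f : P → X) (hlow : IsLowerSet I)
    (hmin : ∀ x, (∀ z, z ≤ x → z = x) → x ∈ I) (hfZ : ∀ x ∈ I, f x ∈ Z) (hmono : MonotoneOn f I)
    (hf : ∀ x ∈ I, f '' minBelow P x = minBelow X (f x)) :
    ∃ g : P → X, IsPMorphism g ∧ (∀ x ∈ I, g x = f x) ∧ ∀ x, g x ∈ Z := by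
  classical
  induction hk : Iᶜ.ncard generalizing I f with
  | zero =>
    rw [Set.ncard_eq_zero (Set.toFinite _), Set.compl_empty_iff] at hk
    subst hk
    exact ⟨f, ⟨fun x y h => hmono trivial trivial h, fun x => hf x trivial⟩, fun _ _ => rfl,
      fun x => hfZ x trivial⟩
  | succ k ih =>
    have hne : Iᶜ.Nonempty := by
      rw [← Set.ncard_pos (Set.toFinite _)]; omega
    obtain ⟨x, hx⟩ := Set.Finite.exists_minimal (Set.toFinite Iᶜ) hne
    have hxI : x ∉ I := hx.1
    have hlt : ∀ y, y < x → y ∈ I := fun y hy => by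
      by_contra hyI
      exact hy.not_ge (hx.2 hyI hy.le)
    have hmlt : ∀ m ∈ minBelow P x, m < x := fun m hm =>
      lt_of_le_of_ne hm.1 fun h => hxI (h ▸ hmin m hm.2)
    obtain ⟨m, hm⟩ := minBelow_nonempty x
    obtain ⟨z, hz, hub, hzmin⟩ := hZ.exists_upperBound (T := f '' Set.Iio x) (Set.toFinite _)
      ⟨f m, m, hmlt m hm, rfl⟩ (by rintro _ ⟨y, hy, rfl⟩; exact hfZ y (hlt y hy))
    have hfx : ∀ y ∈ I, Function.update f x z y = f y := fun y hy =>
      Function.update_of_ne (ne_of_mem_of_not_mem hy hxI) _ _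
    suffices h : ∃ g : P → X, IsPMorphism g ∧
        (∀ y ∈ insert x I, g y = Function.update f x z y) ∧ ∀ y, g y ∈ Z by
      obtain ⟨g, hg, hgf, hgZ⟩ := h
      exact ⟨g, hg, fun y hy => (hgf y (Or.inr hy)).trans (hfx y hy), hgZ⟩
    refine ih (insert x I) (Function.update f x z) ?_
      (fun y hy => Or.inr (hmin y hy)) ?_ ?_ ?_ ?_
    · intro y y' hle hy
      rcases hy with rfl | hy
      · rcases hle.lt_or_eq with h | h
        exacts [Or.inr (hlt _ h), Or.inl h]
      · exact Or.inr (hlow hle hy)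
    · rintro y (rfl | hy)
      · simpa using hz
      · rw [hfx y hy]; exact hfZ y hy
    · intro y hy y' hy' hle
      rcases hy' with rfl | hy'
      · rcases hle.lt_or_eq with h | h
        · rw [hfx y (hlt y h), Function.update_self]
          exact hub _ ⟨y, h, rfl⟩
        · rw [h]
      · have hyI := hlow hle hy'
        rw [hfx y hyI, hfx y' hy']
        exact hmono hyI hy' hle
    · intro y hy
      have himg : Function.update f x z '' minBelow P y = f '' minBelow P y :=
        Set.image_congr fun m hm => hfx m (hmin m hm.2)
      rw [himg]
      rcases hy with rfl | hy
      · rw [Function.update_self, hzmin, Set.biUnion_image]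
        apply Set.Subset.antisymm
        · rintro _ ⟨m, hm, rfl⟩
          refine Set.mem_biUnion (hmlt m hm) ?_
          rw [← hf m (hlt m (hmlt m hm))]
          exact ⟨m, ⟨le_rfl, hm.2⟩, rfl⟩
        · refine Set.iUnion₂_subset fun y' hy' => ?_
          rw [← hf y' (hlt y' hy')]
          exact Set.image_mono (minBelow_subset_of_le (le_of_lt hy'))
      · rw [hfx y hy]; exact hf y hy
    · have : (insert x I)ᶜ = Iᶜ \ {x} := by
        ext y; simp only [Set.mem_compl_iff, Set.mem_insert_iff, Set.mem_sdiff,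
          Set.mem_singleton_iff]; tauto
      rw [this, Set.ncard_sdiff_singleton_of_mem hxI]; omega

lemma IsPMorphism.isConnectedSub_range {P X : Type*} [PartialOrder P] [PartialOrder X]
    (hP : StarCond P) {u : P → X} (hu : IsPMorphism u) : IsConnectedSub X (Set.range u) := by
  constructor
  · rintro _ ⟨p, rfl⟩ m hm
    rw [← hu.2] at hm
    exact Set.image_subset_range _ _ hm
  · rintro _ ⟨p, rfl⟩ _ ⟨q, rfl⟩
    obtain ⟨r, hr, hmin⟩ := hP p q
    refine ⟨u r, ⟨r, rfl⟩, hu.1 (hr.1 (Set.mem_insert _ _)),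
      hu.1 (hr.1 (Set.mem_insert_of_mem _ rfl)), ?_⟩
    rw [← hu.2, hmin, Set.image_union, hu.2, hu.2]

/-- The poset `P` with free joins with the nonempty subsets of `M`. -/
abbrev FreeJoin (P M : Type*) : Type _ :=
  {x : WithBot P × Set M // x ≠ (⊥, ∅)}

namespace FreeJoin

variable {P M : Type*}

/-- The copy of `P` in `FreeJoin P M`. -/
def ofPoset (p : P) : FreeJoin P M := ⟨(p, ∅), by simp⟩

/-- The nonempty subsets of `M` in `FreeJoin P M`. -/
def ofSet (S : Set M) (hS : S.Nonempty) : FreeJoin P M := ⟨(⊥, S), by simpa using hS.ne_empty⟩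

lemma exists_generator_le [PartialOrder P] (x : FreeJoin P M) :
    (∃ p : P, ofPoset p ≤ x) ∨ ∃ s, ofSet {s} (Set.singleton_nonempty s) ≤ x := by
  obtain ⟨⟨p, S⟩, hx⟩ := x
  induction p with
  | bot =>
    have hS : S.Nonempty := Set.nonempty_iff_ne_empty.2 fun h => hx (by rw [h])
    obtain ⟨s, hs⟩ := hS
    exact Or.inr ⟨s, Prod.mk_le_mk.2 ⟨le_rfl, Set.singleton_subset_iff.2 hs⟩⟩
  | coe p => exact Or.inl ⟨p, Prod.mk_le_mk.2 ⟨le_rfl, Set.empty_subset _⟩⟩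

lemma eq_ofPoset_of_le [PartialOrder P] {x : FreeJoin P M} {p : P} (h : x ≤ ofPoset p) :
    ∃ q ≤ p, x = ofPoset q := by
  obtain ⟨⟨q, S⟩, hx⟩ := x
  obtain ⟨h1, h2⟩ := Prod.mk_le_mk.1 h
  obtain rfl : S = ∅ := Set.subset_empty_iff.1 h2
  induction q with
  | bot => exact absurd rfl hx
  | coe q => exact ⟨q, WithBot.coe_le_coe.1 h1, rfl⟩

lemma eq_ofSet_of_le [PartialOrder P] {x : FreeJoin P M} {S : Set M} {hS : S.Nonempty}
    (h : x ≤ ofSet S hS) : ∃ T, ∃ hT : T.Nonempty, T ⊆ S ∧ x = ofSet T hT := by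
  obtain ⟨⟨q, T⟩, hx⟩ := x
  obtain ⟨h1, h2⟩ := Prod.mk_le_mk.1 h
  obtain rfl : q = ⊥ := le_bot_iff.1 h1
  exact ⟨T, Set.nonempty_iff_ne_empty.2 fun h => hx (by rw [h]), h2, rfl⟩

lemma ofPoset_le_iff [PartialOrder P] {p : P} {x : FreeJoin P M} :
    ofPoset p ≤ x ↔ (p : WithBot P) ≤ x.1.1 :=
  ⟨fun h => (Prod.mk_le_mk.1 h).1, fun h => Prod.mk_le_mk.2 ⟨h, Set.empty_subset _⟩⟩

lemma ofSet_le_iff [PartialOrder P] {S : Set M} {hS : S.Nonempty} {x : FreeJoin P M} :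
    ofSet S hS ≤ x ↔ S ⊆ x.1.2 :=
  ⟨fun h => (Prod.mk_le_mk.1 h).2, fun h => Prod.mk_le_mk.2 ⟨bot_le, h⟩⟩

lemma minBelow_eq [PartialOrder P] (x : FreeJoin P M) :
    minBelow (FreeJoin P M) x =
      ofPoset '' {p : P | (p : WithBot P) ≤ x.1.1 ∧ ∀ z, z ≤ p → z = p} ∪
        (fun s => ofSet {s} (Set.singleton_nonempty s)) '' x.1.2 := by
  have hinj : Function.Injective (ofPoset : P → FreeJoin P M) := fun p q h => by
    simpa [ofPoset] using h
  ext m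
  constructor
  · rintro ⟨hm, hmin⟩
    rcases exists_generator_le m with ⟨p, hp⟩ | ⟨s, hs⟩
    · obtain rfl := hmin _ hp
      refine Or.inl ⟨p, ⟨ofPoset_le_iff.1 hm, fun z hz => ?_⟩, rfl⟩
      exact hinj (hmin _ (ofPoset_le_iff.2 (WithBot.coe_le_coe.2 hz)))
    · obtain rfl := hmin _ hs
      exact Or.inr ⟨s, Set.singleton_subset_iff.1 (ofSet_le_iff.1 hm), rfl⟩
  · rintro (⟨p, ⟨hp, hmin⟩, rfl⟩ | ⟨s, hs, rfl⟩)
    · refine ⟨ofPoset_le_iff.2 hp, fun z hz => ?_⟩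
      obtain ⟨q, hq, rfl⟩ := eq_ofPoset_of_le hz
      rw [hmin q hq]
    · refine ⟨ofSet_le_iff.2 (Set.singleton_subset_iff.2 hs), fun z hz => ?_⟩
      obtain ⟨T, hT, hTs, rfl⟩ := eq_ofSet_of_le hz
      congr
      exact (Set.Nonempty.subset_singleton_iff hT).1 hTs

lemma minBelow_ofPoset [PartialOrder P] (p : P) :
    minBelow (FreeJoin P M) (ofPoset p) = ofPoset '' minBelow P p := by
  rw [minBelow_eq]
  simp [ofPoset, minBelow]

lemma minBelow_ofSet [PartialOrder P] (S : Set M) (hS : S.Nonempty) :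
    minBelow (FreeJoin P M) (ofSet S hS) =
      (fun s => ofSet {s} (Set.singleton_nonempty s)) '' S := by
  rw [minBelow_eq]
  simp [ofSet]

lemma isPMorphism_ofPoset [PartialOrder P] :
    IsPMorphism (ofPoset : P → FreeJoin P M) :=
  ⟨fun _ _ h => ofPoset_le_iff.2 (WithBot.coe_le_coe.2 h), fun p => (minBelow_ofPoset p).symm⟩

lemma exists_lub_withBot [PartialOrder P] (hP : StarCond P) (p q : WithBot P) :
    ∃ r : WithBot P, IsLUB {p, q} r ∧
      {m : P | (m : WithBot P) ≤ r ∧ ∀ z, z ≤ m → z = m} =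
        {m : P | (m : WithBot P) ≤ p ∧ ∀ z, z ≤ m → z = m} ∪
          {m : P | (m : WithBot P) ≤ q ∧ ∀ z, z ≤ m → z = m} := by
  induction p with
  | bot => exact ⟨q, isLUB_pair_of_le bot_le, by simp⟩
  | coe p =>
    induction q with
    | bot => exact ⟨p, Set.pair_comm (⊥ : WithBot P) p ▸ isLUB_pair_of_le bot_le, by simp⟩
    | coe q =>
      obtain ⟨r, hr, hmin⟩ := hP p q
      refine ⟨r, ⟨?_, ?_⟩, by simpa only [WithBot.coe_le_coe, minBelow] using hmin⟩
      · rintro _ (rfl | rfl)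
        · exact WithBot.coe_le_coe.2 (hr.1 (Set.mem_insert _ _))
        · exact WithBot.coe_le_coe.2 (hr.1 (Set.mem_insert_of_mem _ rfl))
      · intro z hz
        have h1 : (p : WithBot P) ≤ z := hz (Set.mem_insert _ _)
        have h2 : (q : WithBot P) ≤ z := hz (Set.mem_insert_of_mem _ rfl)
        induction z with
        | bot => exact absurd h1 (by simp)
        | coe z =>
          refine WithBot.coe_le_coe.2 (hr.2 ?_)
          rintro _ (rfl | rfl)
          exacts [WithBot.coe_le_coe.1 h1, WithBot.coe_le_coe.1 h2]

lemma starCond [PartialOrder P] (hP : StarCond P) : StarCond (FreeJoin P M) := by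
  intro x y
  obtain ⟨r, hr, hmin⟩ := exists_lub_withBot hP x.1.1 y.1.1
  have hxr : x.1.1 ≤ r := hr.1 (Set.mem_insert _ _)
  have hyr : y.1.1 ≤ r := hr.1 (Set.mem_insert_of_mem _ rfl)
  have hne : (r, x.1.2 ∪ y.1.2) ≠ ((⊥ : WithBot P), (∅ : Set M)) := by
    intro h
    obtain ⟨h1, h2⟩ := Prod.mk.inj h
    rw [h1, le_bot_iff] at hxr
    exact x.2 (Prod.ext hxr (Set.union_empty_iff.1 h2).1)
  refine ⟨⟨(r, x.1.2 ∪ y.1.2), hne⟩, ⟨?_, ?_⟩, ?_⟩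
  · rintro _ (rfl | rfl)
    · exact ⟨hxr, Set.subset_union_left⟩
    · exact ⟨hyr, Set.subset_union_right⟩
  · intro z hz
    have h1 : x.1 ≤ z.1 := hz (Set.mem_insert _ _)
    have h2 : y.1 ≤ z.1 := hz (Set.mem_insert_of_mem _ rfl)
    refine ⟨hr.2 ?_, Set.union_subset h1.2 h2.2⟩
    rintro _ (rfl | rfl)
    exacts [h1.1, h2.1]
  · rw [minBelow_eq, minBelow_eq, minBelow_eq, hmin, Set.image_union, Set.image_union]
    ext m
    simp only [Set.mem_union]
    tauto

end FreeJoin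

/-- `R` is a nonempty proper subset of `A ∪ B`, with flags that may only be raised when `R`
contains `A`, respectively `B`. -/
def IsFlaggedPart {X : Type*} (A B R : Set X) (α β : Prop) : Prop :=
  R.Nonempty ∧ R ⊆ A ∪ B ∧ R ≠ A ∪ B ∧ (α → A ⊆ R) ∧ (β → B ⊆ R)

/-- A compatible choice `l` of joins of the proper subsets of `minBelow X a ∪ minBelow X b`,
together with `a` and `b` when the respective flag is raised, below two elements `c` and `d`. -/
structure IsJoinSystem {X : Type*} [PartialOrder X] (a b c d : X)
    (l : Set X → Prop → Prop → X) : Prop where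
  left_not_subset : ¬ minBelow X a ⊆ minBelow X b
  right_not_subset : ¬ minBelow X b ⊆ minBelow X a
  minBelow_c : minBelow X c = minBelow X a ∪ minBelow X b
  minBelow_d : minBelow X d = minBelow X a ∪ minBelow X b
  minBelow_l : ∀ {R α β}, IsFlaggedPart (minBelow X a) (minBelow X b) R α β →
    minBelow X (l R α β) = R
  mono : ∀ {R α β R' α' β'}, IsFlaggedPart (minBelow X a) (minBelow X b) R α β →
    IsFlaggedPart (minBelow X a) (minBelow X b) R' α' β' → R ⊆ R' → (α → α') → (β → β') →
    l R α β ≤ l R' α' β'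
  le_c : ∀ {R α β}, IsFlaggedPart (minBelow X a) (minBelow X b) R α β → l R α β ≤ c
  le_d : ∀ {R α β}, IsFlaggedPart (minBelow X a) (minBelow X b) R α β → l R α β ≤ d
  singleton : ∀ {m α β}, IsFlaggedPart (minBelow X a) (minBelow X b) {m} α β → ¬ α → ¬ β →
    l {m} α β = m
  left : ∀ {α β}, α → ¬ β → l (minBelow X a) α β = a
  right : ∀ {α β}, ¬ α → β → l (minBelow X b) α β = b

lemma exists_isJoinSystem {X : Type*} [PartialOrder X] [Finite X] {Y : Set X}
    (hY : IsConnectedSub X Y) {a b c d : X} (ha : a ∈ Y) (hb : b ∈ Y) (hc : c ∈ Y) (hd : d ∈ Y)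
    {n : ℕ} (h1 : StarCondN' (n - 1) {y : X // y ∈ Y})
    (h2 : (minBelow X a ∪ minBelow X b).ncard = n)
    (h3a : ¬ minBelow X a ⊆ minBelow X b) (h3b : ¬ minBelow X b ⊆ minBelow X a)
    (h4c : minBelow X c = minBelow X a ∪ minBelow X b)
    (h4d : minBelow X d = minBelow X a ∪ minBelow X b)
    (h5 : a ≤ c ∧ a ≤ d ∧ b ≤ c ∧ b ≤ d) :
    ∃ l, IsJoinSystem a b c d l ∧
      ∀ R α β, IsFlaggedPart (minBelow X a) (minBelow X b) R α β → l R α β ∈ Y := by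
  have hAY : minBelow X a ∪ minBelow X b ⊆ Y := Set.union_subset (hY.1 a ha) (hY.1 b hb)
  have hminimal : ∀ m ∈ minBelow X a ∪ minBelow X b, ∀ z, z ≤ m → z = m := by
    rintro m (hm | hm)
    exacts [hm.2, hm.2]
  have hsing : ∀ m ∈ minBelow X a ∪ minBelow X b, minBelow X m = {m} := fun m hm =>
    minBelow_eq_singleton (hminimal m hm)
  have key : ∀ R α β, ∃ z, IsFlaggedPart (minBelow X a) (minBelow X b) R α β →
      z ∈ Y ∧ (∀ t ∈ {t | t ∈ R ∨ (α ∧ t = a) ∨ (β ∧ t = b)}, t ≤ z) ∧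
      (∀ y ∈ Y, (∀ t ∈ {t | t ∈ R ∨ (α ∧ t = a) ∨ (β ∧ t = b)}, t ≤ y) → z ≤ y) ∧
      minBelow X z = R := by
    intro R α β
    by_cases hR : IsFlaggedPart (minBelow X a) (minBelow X b) R α β
    swap
    · exact ⟨a, fun h => absurd h hR⟩
    obtain ⟨hne, hsub, hneq, hα, hβ⟩ := hR
    have hU : (⋃ t ∈ {t | t ∈ R ∨ (α ∧ t = a) ∨ (β ∧ t = b)}, minBelow X t) = R := by
      apply Set.Subset.antisymm
      · refine Set.iUnion₂_subset ?_
        rintro t (ht | ⟨h, rfl⟩ | ⟨h, rfl⟩)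
        · rw [hsing t (hsub ht)]; exact Set.singleton_subset_iff.2 ht
        · exact hα h
        · exact hβ h
      · intro m hm
        exact Set.mem_biUnion (Or.inl hm) (by rw [hsing m (hsub hm)]; rfl)
    have hlt : R.ncard < n := by
      rw [← h2]
      exact Set.ncard_lt_ncard (hsub.ssubset_of_ne hneq) (Set.toFinite _)
    have hpos : 0 < R.ncard := (Set.ncard_pos (Set.toFinite _)).2 hne
    rw [StarCondN', if_neg (by omega)] at h1
    obtain ⟨z, hz, hz1, hz2, hz3⟩ := hY.exists_lub h1
      (T := {t | t ∈ R ∨ (α ∧ t = a) ∨ (β ∧ t = b)}) (Set.toFinite _)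
      (hne.mono fun _ h => Or.inl h) (by
        rintro t (ht | ⟨-, rfl⟩ | ⟨-, rfl⟩)
        exacts [hAY (hsub ht), ha, hb]) (by rw [hU]; omega)
    exact ⟨z, fun _ => ⟨hz, hz1, hz2, hz3.trans hU⟩⟩
  choose l hl using key
  have hle : ∀ {R α β y}, IsFlaggedPart (minBelow X a) (minBelow X b) R α β → y ∈ Y →
      (∀ m ∈ R, m ≤ y) → (α → a ≤ y) → (β → b ≤ y) → l R α β ≤ y := by
    intro R α β y hR hy h h' h''
    refine (hl R α β hR).2.2.1 y hy ?_
    rintro t (ht | ⟨hα, rfl⟩ | ⟨hβ, rfl⟩)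
    exacts [h t ht, h' hα, h'' hβ]
  refine ⟨l, ⟨h3a, h3b, h4c, h4d, fun h => (hl _ _ _ h).2.2.2, ?_, ?_, ?_, ?_, ?_, ?_⟩,
    fun R α β h => (hl R α β h).1⟩
  · intro R α β R' α' β' h h' hR hα hβ
    refine hle h (hl _ _ _ h').1 (fun m hm => ?_) (fun h1 => ?_) (fun h1 => ?_)
    · exact (hl _ _ _ h').2.1 m (Or.inl (hR hm))
    · exact (hl _ _ _ h').2.1 a (Or.inr (Or.inl ⟨hα h1, rfl⟩))
    · exact (hl _ _ _ h').2.1 b (Or.inr (Or.inr ⟨hβ h1, rfl⟩))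
  · intro R α β h
    exact hle h hc (fun m hm => (h4c.symm ▸ h.2.1 hm : m ∈ minBelow X c).1) (fun _ => h5.1)
      (fun _ => h5.2.2.1)
  · intro R α β h
    exact hle h hd (fun m hm => (h4d.symm ▸ h.2.1 hm : m ∈ minBelow X d).1) (fun _ => h5.2.1)
      (fun _ => h5.2.2.2)
  · intro m α β h hα hβ
    have hm := h.2.1 (Set.mem_singleton m)
    refine hminimal m hm _ (hle h (hAY hm) ?_ (absurd · hα) (absurd · hβ))
    rintro _ rfl
    exact le_rfl
  · intro α β hα hβ
    have h : IsFlaggedPart (minBelow X a) (minBelow X b) (minBelow X a) α β :=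
      ⟨minBelow_nonempty a, Set.subset_union_left,
        fun h => h3b (h.symm ▸ Set.subset_union_right), fun _ => le_rfl, (absurd · hβ)⟩
    exact le_antisymm (hle h ha (fun m hm => hm.1) (fun _ => le_rfl) (absurd · hβ))
      ((hl _ _ _ h).2.1 a (Or.inr (Or.inl ⟨hα, rfl⟩)))
  · intro α β hα hβ
    have h : IsFlaggedPart (minBelow X a) (minBelow X b) (minBelow X b) α β :=
      ⟨minBelow_nonempty b, Set.subset_union_right,
        fun h => h3a (h.symm ▸ Set.subset_union_left), (absurd · hα), fun _ => le_rfl⟩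
    exact le_antisymm (hle h hb (fun m hm => hm.1) (absurd · hα) (fun _ => le_rfl))
      ((hl _ _ _ h).2.1 b (Or.inr (Or.inr ⟨hβ, rfl⟩)))

/-- Minimal elements of the fence: `k` doubled copies of `A` and `k` doubled copies of `B`. -/
abbrev FenceIndex {X : Type*} (A B : Set X) (k : ℕ) : Type _ :=
  (Fin k × Bool × A) ⊕ (Fin k × Bool × B)

namespace FenceIndex

variable {X : Type*} {A B : Set X} {k : ℕ}

/-- The element of `X` underlying an element of the fence. -/
def proj : FenceIndex A B k → X := Sum.elim (fun s => s.2.2) (fun s => s.2.2)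

/-- The `i`-th copy of `A`. -/
def leftCopy (A B : Set X) {k : ℕ} (i : Fin k) : Set (FenceIndex A B k) :=
  {s | ∃ e x, s = Sum.inl (i, e, x)}

/-- The `j`-th copy of `B`. -/
def rightCopy (A B : Set X) {k : ℕ} (j : Fin k) : Set (FenceIndex A B k) :=
  {s | ∃ e y, s = Sum.inr (j, e, y)}

lemma proj_mem (s : FenceIndex A B k) : proj s ∈ A ∪ B := by
  rcases s with ⟨_, _, x⟩ | ⟨_, _, x⟩
  exacts [Or.inl x.2, Or.inr x.2]

lemma proj_image_left (i : Fin k) : proj '' leftCopy A B i = A := by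
  ext x
  constructor
  · rintro ⟨_, ⟨e, x, rfl⟩, rfl⟩; exact x.2
  · exact fun hx => ⟨_, ⟨true, ⟨x, hx⟩, rfl⟩, rfl⟩

lemma proj_image_right (j : Fin k) : proj '' rightCopy A B j = B := by
  ext x
  constructor
  · rintro ⟨_, ⟨e, x, rfl⟩, rfl⟩; exact x.2
  · exact fun hx => ⟨_, ⟨true, ⟨x, hx⟩, rfl⟩, rfl⟩

lemma leftCopy_nonempty (hA : A.Nonempty) (i : Fin k) : (leftCopy A B i).Nonempty :=
  let ⟨x, hx⟩ := hA; ⟨_, true, ⟨x, hx⟩, rfl⟩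

lemma rightCopy_nonempty (hB : B.Nonempty) (j : Fin k) : (rightCopy A B j).Nonempty :=
  let ⟨x, hx⟩ := hB; ⟨_, true, ⟨x, hx⟩, rfl⟩

lemma not_left_subset_right (hA : A.Nonempty) (i j : Fin k) : ¬ leftCopy A B i ⊆ rightCopy A B j := by
  obtain ⟨x, hx⟩ := hA
  intro h
  obtain ⟨_, _, h'⟩ := h ⟨true, ⟨x, hx⟩, rfl⟩
  exact Sum.inl_ne_inr h'

lemma not_right_subset_left (hB : B.Nonempty) (i j : Fin k) : ¬ rightCopy A B j ⊆ leftCopy A B i := by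
  obtain ⟨x, hx⟩ := hB
  intro h
  obtain ⟨_, _, h'⟩ := h ⟨true, ⟨x, hx⟩, rfl⟩
  exact Sum.inr_ne_inl h'

/-- If `S` lies over `A ∪ B` and below the `i`-th copy of `A` and the `j`-th copy of `B`, then
it determines `i` and `j`. -/
lemma eq_of_subset (hAB : ¬ A ⊆ B) (hBA : ¬ B ⊆ A) {S : Set (FenceIndex A B k)}
    (hS : proj '' S = A ∪ B) {i j i' j' : Fin k} (h : S ⊆ leftCopy A B i ∪ rightCopy A B j)
    (h' : S ⊆ leftCopy A B i' ∪ rightCopy A B j') : i = i' ∧ j = j' := by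
  constructor
  · obtain ⟨x, hx, hxB⟩ := Set.not_subset.1 hAB
    obtain ⟨s, hs, rfl⟩ := hS.symm.subset (Or.inl hx)
    rcases h hs with ⟨e, y, rfl⟩ | ⟨e, y, rfl⟩
    · rcases h' hs with ⟨e', y', h''⟩ | ⟨e', y', h''⟩
      · exact (Prod.mk.inj (Sum.inl.inj h'')).1
      · exact absurd h'' Sum.inl_ne_inr
    · exact absurd y.2 hxB
  · obtain ⟨x, hx, hxA⟩ := Set.not_subset.1 hBA
    obtain ⟨s, hs, rfl⟩ := hS.symm.subset (Or.inr hx)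
    rcases h hs with ⟨e, y, rfl⟩ | ⟨e, y, rfl⟩
    · exact absurd y.2 hxA
    · rcases h' hs with ⟨e', y', h''⟩ | ⟨e', y', h''⟩
      · exact absurd h'' Sum.inr_ne_inl
      · exact (Prod.mk.inj (Sum.inr.inj h'')).1

/-- Every flagged part comes from a set of fence elements. -/
lemma exists_set {R : Set X} {α β : Prop} (h : IsFlaggedPart A B R α β) (hA : A.Nonempty)
    (hB : B.Nonempty) (hk : 0 < k) : ∃ S : Set (FenceIndex A B k), proj '' S = R ∧
      ((∃ i, leftCopy A B i ⊆ S) ↔ α) ∧ ((∃ j, rightCopy A B j ⊆ S) ↔ β) := by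
  obtain ⟨-, hsub, -, hα, hβ⟩ := h
  refine ⟨{s | proj s ∈ R ∧ Sum.elim (fun s => s.2.1 = true → α) (fun s => s.2.1 = true → β) s},
    ?_, ?_, ?_⟩
  · ext x
    constructor
    · rintro ⟨s, hs, rfl⟩; exact hs.1
    · intro hx
      rcases hsub hx with h | h
      · exact ⟨Sum.inl (⟨0, hk⟩, false, ⟨x, h⟩), ⟨hx, by simp⟩, rfl⟩
      · exact ⟨Sum.inr (⟨0, hk⟩, false, ⟨x, h⟩), ⟨hx, by simp⟩, rfl⟩
  · constructor
    · rintro ⟨i, hi⟩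
      obtain ⟨x, hx⟩ := hA
      exact (hi ⟨true, ⟨x, hx⟩, rfl⟩).2 rfl
    · intro h
      refine ⟨⟨0, hk⟩, ?_⟩
      rintro _ ⟨e, x, rfl⟩
      exact ⟨hα h x.2, fun _ => h⟩
  · constructor
    · rintro ⟨i, hi⟩
      obtain ⟨x, hx⟩ := hB
      exact (hi ⟨true, ⟨x, hx⟩, rfl⟩).2 rfl
    · intro h
      refine ⟨⟨0, hk⟩, ?_⟩
      rintro _ ⟨e, x, rfl⟩
      exact ⟨hβ h x.2, fun _ => h⟩

lemma isFlaggedPart {S : Set (FenceIndex A B k)} (hS : S.Nonempty)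
    (h : proj '' S ≠ A ∪ B) :
    IsFlaggedPart A B (proj '' S) (∃ i, leftCopy A B i ⊆ S) (∃ j, rightCopy A B j ⊆ S) := by
  refine ⟨hS.image _, ?_, h, ?_, ?_⟩
  · rintro _ ⟨s, -, rfl⟩; exact proj_mem s
  · rintro ⟨i, hi⟩
    exact (proj_image_left i).symm.subset.trans (Set.image_mono hi)
  · rintro ⟨i, hi⟩
    exact (proj_image_right i).symm.subset.trans (Set.image_mono hi)

end FenceIndex

open FenceIndex in
open scoped Classical in
/-- The map to `X` on small sets of fence elements: the join of the `i`-th copy of `A` and the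
`j`-th copy of `B` goes to `c` if `i ≤ j` and to `d` otherwise. -/
noncomputable def fenceMap {X : Type*} (A B : Set X) (c d : X) (l : Set X → Prop → Prop → X)
    {k : ℕ} (S : Set (FenceIndex A B k)) : X :=
  if proj '' S = A ∪ B then
    if ∃ i j, i ≤ j ∧ S ⊆ leftCopy A B i ∪ rightCopy A B j then c else d
  else l (proj '' S) (∃ i, leftCopy A B i ⊆ S) (∃ j, rightCopy A B j ⊆ S)

namespace IsJoinSystem

open FenceIndex

variable {X : Type*} [PartialOrder X] {a b c d : X} {l : Set X → Prop → Prop → X} {k : ℕ}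

lemma minBelow_fenceMap (h : IsJoinSystem a b c d l)
    {S : Set (FenceIndex (minBelow X a) (minBelow X b) k)} (hS : S.Nonempty) :
    minBelow X (fenceMap (minBelow X a) (minBelow X b) c d l S) = proj '' S := by
  unfold fenceMap
  split_ifs with h1 h2
  · rw [h1, h.minBelow_c]
  · rw [h1, h.minBelow_d]
  · exact h.minBelow_l (isFlaggedPart hS h1)

lemma fenceMap_mem {Z : Set X}
    (hl : ∀ R α β, IsFlaggedPart (minBelow X a) (minBelow X b) R α β → l R α β ∈ Z)
    (hc : c ∈ Z) (hd : d ∈ Z)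
    {S : Set (FenceIndex (minBelow X a) (minBelow X b) k)} (hS : S.Nonempty) :
    fenceMap (minBelow X a) (minBelow X b) c d l S ∈ Z := by
  unfold fenceMap
  split_ifs with h1 h2
  · exact hc
  · exact hd
  · exact hl _ _ _ (isFlaggedPart hS h1)

lemma singleton_ne_union (h : IsJoinSystem a b c d l) (m : X) :
    {m} ≠ minBelow X a ∪ minBelow X b := by
  intro hm
  obtain ⟨x, hx, hxb⟩ := Set.not_subset.1 h.left_not_subset
  obtain ⟨y, hy, hya⟩ := Set.not_subset.1 h.right_not_subset
  obtain rfl : x = m := hm.symm.subset (Or.inl hx)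
  obtain rfl : y = x := hm.symm.subset (Or.inr hy)
  exact hya hx

lemma left_nonempty (h : IsJoinSystem a b c d l) : (minBelow X a).Nonempty :=
  let ⟨x, hx, _⟩ := Set.not_subset.1 h.left_not_subset; ⟨x, hx⟩

lemma right_nonempty (h : IsJoinSystem a b c d l) : (minBelow X b).Nonempty :=
  let ⟨x, hx, _⟩ := Set.not_subset.1 h.right_not_subset; ⟨x, hx⟩

lemma fenceMap_singleton (h : IsJoinSystem a b c d l)
    (s : FenceIndex (minBelow X a) (minBelow X b) k) :
    fenceMap (minBelow X a) (minBelow X b) c d l {s} = proj s := by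
  have h1 : proj '' {s} ≠ minBelow X a ∪ minBelow X b := by
    rw [Set.image_singleton]; exact h.singleton_ne_union _
  have h2 := isFlaggedPart (Set.singleton_nonempty s) h1
  rw [fenceMap, if_neg h1]
  rw [Set.image_singleton] at h2 ⊢
  refine h.singleton h2 ?_ ?_
  · rintro ⟨i, hi⟩
    obtain ⟨x, hx⟩ := h.left_nonempty
    have h3 := hi ⟨true, ⟨x, hx⟩, rfl⟩
    have h4 := hi ⟨false, ⟨x, hx⟩, rfl⟩
    simpa using h3.trans h4.symm
  · rintro ⟨i, hi⟩
    obtain ⟨x, hx⟩ := h.right_nonempty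
    have h3 := hi ⟨true, ⟨x, hx⟩, rfl⟩
    have h4 := hi ⟨false, ⟨x, hx⟩, rfl⟩
    simpa using h3.trans h4.symm

lemma fenceMap_left (h : IsJoinSystem a b c d l) (i : Fin k) :
    fenceMap (minBelow X a) (minBelow X b) c d l (leftCopy _ _ i) = a := by
  rw [fenceMap, proj_image_left, if_neg]
  · exact h.left ⟨i, le_rfl⟩ fun ⟨j, hj⟩ => not_right_subset_left h.right_nonempty _ _ hj
  · exact fun h' => h.right_not_subset (h'.symm ▸ Set.subset_union_right)

lemma fenceMap_right (h : IsJoinSystem a b c d l) (j : Fin k) :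
    fenceMap (minBelow X a) (minBelow X b) c d l (rightCopy _ _ j) = b := by
  rw [fenceMap, proj_image_right, if_neg]
  · exact h.right (fun ⟨i, hi⟩ => not_left_subset_right h.left_nonempty _ _ hi) ⟨j, le_rfl⟩
  · exact fun h' => h.left_not_subset (h'.symm ▸ Set.subset_union_left)

lemma fenceMap_union (h : IsJoinSystem a b c d l) (i j : Fin k) :
    fenceMap (minBelow X a) (minBelow X b) c d l (leftCopy _ _ i ∪ rightCopy _ _ j) =
      if i ≤ j then c else d := by
  have h1 : proj '' (leftCopy (minBelow X a) (minBelow X b) i ∪ rightCopy _ _ j) =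
      minBelow X a ∪ minBelow X b := by
    rw [Set.image_union, proj_image_left, proj_image_right]
  rw [fenceMap, if_pos h1]
  congr 1
  rw [eq_iff_iff]
  constructor
  · rintro ⟨i', j', hle, hsub⟩
    obtain ⟨rfl, rfl⟩ := eq_of_subset h.left_not_subset h.right_not_subset h1 le_rfl hsub
    exact hle
  · exact fun hle => ⟨i, j, hle, le_rfl⟩

lemma fenceMap_mono (h : IsJoinSystem a b c d l)
    {S T : Set (FenceIndex (minBelow X a) (minBelow X b) k)} (hS : S.Nonempty) (hST : S ⊆ T)
    (hT : proj '' T ≠ minBelow X a ∪ minBelow X b ∨ ∃ i j, T ⊆ leftCopy _ _ i ∪ rightCopy _ _ j) :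
    fenceMap (minBelow X a) (minBelow X b) c d l S ≤
      fenceMap (minBelow X a) (minBelow X b) c d l T := by
  by_cases hTp : proj '' T = minBelow X a ∪ minBelow X b
  · by_cases hSp : proj '' S = minBelow X a ∪ minBelow X b
    · rw [fenceMap, fenceMap, if_pos hTp, if_pos hSp]
      obtain ⟨i, j, hij⟩ := hT.resolve_left (absurd hTp)
      apply le_of_eq
      congr 1
      rw [eq_iff_iff]
      constructor
      · rintro ⟨i', j', hle, hsub⟩
        obtain ⟨rfl, rfl⟩ := eq_of_subset h.left_not_subset h.right_not_subset hSp hsub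
          (hST.trans hij)
        exact ⟨_, _, hle, hij⟩
      · rintro ⟨i', j', hle, hsub⟩
        exact ⟨i', j', hle, hST.trans hsub⟩
    · rw [fenceMap, fenceMap, if_pos hTp, if_neg hSp]
      split_ifs
      exacts [h.le_c (isFlaggedPart hS hSp), h.le_d (isFlaggedPart hS hSp)]
  · have hSp : proj '' S ≠ minBelow X a ∪ minBelow X b := by
      intro hSp
      refine hTp (Set.Subset.antisymm (isFlaggedPart (hS.mono hST) hTp).2.1 ?_)
      rw [← hSp]
      exact Set.image_mono hST
    rw [fenceMap, fenceMap, if_neg hTp, if_neg hSp]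
    exact h.mono (isFlaggedPart hS hSp) (isFlaggedPart (hS.mono hST) hTp) (Set.image_mono hST)
      (fun ⟨i, hi⟩ => ⟨i, hi.trans hST⟩) (fun ⟨i, hi⟩ => ⟨i, hi.trans hST⟩)

end IsJoinSystem

open FenceIndex in
/-- A unifier `w` with values in a connected set `Z` that contains a join system has a common
upper bound with the fence of length `k`. -/
lemma IsJoinSystem.exists_fence_unifier {X : Type} [PartialOrder X] [Finite X] {a b c d : X}
    {l : Set X → Prop → Prop → X} (h : IsJoinSystem a b c d l) {Z : Set X}
    (hZ : IsConnectedSub X Z)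
    (hl : ∀ R α β, IsFlaggedPart (minBelow X a) (minBelow X b) R α β → l R α β ∈ Z)
    (hc : c ∈ Z) (hd : d ∈ Z) (w : Unifier X) (hw : ∀ x, w.u x ∈ Z) (k : ℕ) :
    ∃ v : Unifier X, UnifierLE w v ∧
      (∃ (p q : Fin k → v.Y) (r : Fin k → Fin k → v.Y),
        (∀ i, v.u (p i) = a) ∧ (∀ j, v.u (q j) = b) ∧ (∀ i j, p i ≤ r i j ∧ q j ≤ r i j) ∧
        ∀ i j, v.u (r i j) = if i ≤ j then c else d) ∧
      (0 < k → ∀ R α β, IsFlaggedPart (minBelow X a) (minBelow X b) R α β →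
        ∃ y, v.u y = l R α β) := by
  set M := FenceIndex (minBelow X a) (minBelow X b) k
  let J : Set (Set M) := {S | proj '' S ≠ minBelow X a ∪ minBelow X b ∨
    ∃ i j, S ⊆ leftCopy _ _ i ∪ rightCopy _ _ j}
  have hJ : ∀ {S T : Set M}, S.Nonempty → S ⊆ T → T ∈ J → S ∈ J := by
    rintro S T hS hST (hT | ⟨i, j, hT⟩)
    · refine Or.inl fun hS' => hT ?_
      exact Set.Subset.antisymm (isFlaggedPart (hS.mono hST) hT).2.1
        (hS'.symm.subset.trans (Set.image_mono hST))
    · exact Or.inr ⟨i, j, hST.trans hT⟩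
  let I : Set (FreeJoin w.Y M) := {x | (∃ p, x = FreeJoin.ofPoset p) ∨
    ∃ S, ∃ hS : S.Nonempty, S ∈ J ∧ x = FreeJoin.ofSet S hS}
  let f : FreeJoin w.Y M → X := fun x =>
    WithBot.recBotCoe (C := fun _ => X) (fenceMap (minBelow X a) (minBelow X b) c d l x.1.2)
      w.u x.1.1
  have hlow : IsLowerSet I := by
    rintro x y hle (⟨p, rfl⟩ | ⟨S, hS, hSJ, rfl⟩)
    · obtain ⟨q, -, rfl⟩ := FreeJoin.eq_ofPoset_of_le hle
      exact Or.inl ⟨q, rfl⟩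
    · obtain ⟨T, hT, hTS, rfl⟩ := FreeJoin.eq_ofSet_of_le hle
      exact Or.inr ⟨T, hT, hJ hT hTS hSJ, rfl⟩
  have hmin : ∀ x, (∀ z : FreeJoin w.Y M, z ≤ x → z = x) → x ∈ I := by
    intro x hx
    rcases FreeJoin.exists_generator_le x with ⟨p, hp⟩ | ⟨s, hs⟩
    · exact Or.inl ⟨p, (hx _ hp).symm⟩
    · refine Or.inr ⟨{s}, Set.singleton_nonempty s, Or.inl ?_, (hx _ hs).symm⟩
      rw [Set.image_singleton]
      exact h.singleton_ne_union _
  have hfZ : ∀ x ∈ I, f x ∈ Z := by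
    rintro x (⟨p, rfl⟩ | ⟨S, hS, -, rfl⟩)
    exacts [hw p, fenceMap_mem hl hc hd hS]
  have hmono : MonotoneOn f I := by
    rintro x - y (⟨p, rfl⟩ | ⟨S, hS, hSJ, rfl⟩) hle
    · obtain ⟨q, hq, rfl⟩ := FreeJoin.eq_ofPoset_of_le hle
      exact w.hu.1 hq
    · obtain ⟨T, hT, hTS, rfl⟩ := FreeJoin.eq_ofSet_of_le hle
      exact h.fenceMap_mono hT hTS hSJ
  have hf : ∀ x ∈ I, f '' minBelow _ x = minBelow X (f x) := by
    rintro x (⟨p, rfl⟩ | ⟨S, hS, -, rfl⟩)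
    · rw [FreeJoin.minBelow_ofPoset, Set.image_image]
      exact w.hu.2 p
    · rw [FreeJoin.minBelow_ofSet, Set.image_image]
      refine Eq.trans ?_ (h.minBelow_fenceMap hS).symm
      exact Set.image_congr fun s _ => h.fenceMap_singleton s
  obtain ⟨g, hg, hgf, -⟩ := exists_pMorphism_extension hZ I f hlow hmin hfZ hmono hf
  have hgS : ∀ S (hS : S.Nonempty), S ∈ J → g (FreeJoin.ofSet S hS) =
      fenceMap (minBelow X a) (minBelow X b) c d l S := fun S hS hSJ =>
    hgf _ (Or.inr ⟨S, hS, hSJ, rfl⟩)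
  have hp := leftCopy_nonempty (B := minBelow X b) (k := k) h.left_nonempty
  have hq := rightCopy_nonempty (A := minBelow X a) (k := k) h.right_nonempty
  refine ⟨⟨FreeJoin w.Y M, ⟨FreeJoin.ofPoset w.ne.some⟩, FreeJoin.starCond w.star, g, hg⟩,
    ⟨FreeJoin.ofPoset, FreeJoin.isPMorphism_ofPoset, ?_⟩,
    ⟨fun i => FreeJoin.ofSet _ (hp i), fun j => FreeJoin.ofSet _ (hq j),
      fun i j => FreeJoin.ofSet (leftCopy _ _ i ∪ rightCopy _ _ j) ((hp i).inl), ?_, ?_, ?_, ?_⟩, ?_⟩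
  · funext p
    exact hgf _ (Or.inl ⟨p, rfl⟩)
  · exact fun i => (hgS _ _ (Or.inr ⟨i, i, Set.subset_union_left⟩)).trans (h.fenceMap_left i)
  · exact fun j => (hgS _ _ (Or.inr ⟨j, j, Set.subset_union_right⟩)).trans (h.fenceMap_right j)
  · exact fun i j => ⟨FreeJoin.ofSet_le_iff.2 Set.subset_union_left,
      FreeJoin.ofSet_le_iff.2 Set.subset_union_right⟩
  · exact fun i j => (hgS _ _ (Or.inr ⟨i, j, le_rfl⟩)).trans (h.fenceMap_union i j)
  · intro hk R α β hR
    obtain ⟨S, hSR, hα, hβ⟩ := exists_set hR h.left_nonempty h.right_nonempty hk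
    have hS : S.Nonempty := by rw [← Set.image_nonempty (f := proj), hSR]; exact hR.1
    have hne : proj '' S ≠ minBelow X a ∪ minBelow X b := hSR ▸ hR.2.2.1
    refine ⟨FreeJoin.ofSet S hS, (hgS S hS (Or.inl hne)).trans ?_⟩
    rw [fenceMap, if_neg hne, hSR, propext hα, propext hβ]

/-- A unifier of smaller cardinality than the length of a fence cannot be above it. -/
lemma not_unifierLE_of_fence {X : Type} [PartialOrder X] [Finite X] {a b c d : X}
    (hno : ¬ ∃ e, a ≤ e ∧ b ≤ e ∧ e ≤ c ∧ e ≤ d) {v w : Unifier X} {k : ℕ}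
    (hk : Nat.card w.Y < k) {p q : Fin k → v.Y} {r : Fin k → Fin k → v.Y}
    (hp : ∀ i, v.u (p i) = a) (hq : ∀ j, v.u (q j) = b) (hle : ∀ i j, p i ≤ r i j ∧ q j ≤ r i j)
    (hr : ∀ i j, v.u (r i j) = if i ≤ j then c else d) : ¬ UnifierLE v w := by
  rintro ⟨ψ, hψ, hcomp⟩
  have hu : ∀ y, w.u (ψ y) = v.u y := congrFun hcomp
  have hninj : ¬ Function.Injective fun i => ψ (p i) := fun hinj => by
    have := Nat.card_le_card_of_injective _ hinj
    rw [Nat.card_fin] at this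
    omega
  obtain ⟨i, i', hii, heq⟩ : ∃ i i', i < i' ∧ ψ (p i) = ψ (p i') := by
    simp only [Function.Injective, not_forall] at hninj
    obtain ⟨i, i', heq, hne⟩ := hninj
    rcases lt_or_gt_of_ne hne with hlt | hlt
    exacts [⟨i, i', hlt, heq⟩, ⟨i', i, hlt, heq.symm⟩]
  obtain ⟨s, hs, -⟩ := w.star (ψ (p i)) (ψ (q i))
  refine hno ⟨w.u s, ?_, ?_, ?_, ?_⟩
  · rw [← hp i, ← hu]
    exact w.hu.1 (hs.1 (Set.mem_insert _ _))
  · rw [← hq i, ← hu]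
    exact w.hu.1 (hs.1 (Set.mem_insert_of_mem _ rfl))
  · have hc := hr i i
    rw [if_pos le_rfl] at hc
    rw [← hc, ← hu]
    refine w.hu.1 (hs.2 ?_)
    rintro _ (rfl | rfl)
    exacts [hψ.1 (hle i i).1, hψ.1 (hle i i).2]
  · have hd := hr i' i
    rw [if_neg hii.not_ge] at hd
    rw [← hd, ← hu]
    refine w.hu.1 (hs.2 ?_)
    rintro _ (rfl | rfl)
    exacts [heq ▸ hψ.1 (hle i' i).1, hψ.1 (hle i' i).2]

/-- An element squeezed between elements of a maximal connected set with the same minimal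
elements belongs to that set. -/
lemma IsConnectedSub.mem_of_maximal {X : Type*} [PartialOrder X] {Y : Set X}
    (hY : IsConnectedSub X Y) (hmax : ∀ Z : Set X, IsConnectedSub X Z → Y ⊆ Z → Y = Z)
    {c e : X} (hc : c ∈ Y) (hec : e ≤ c) (hmin : minBelow X e = minBelow X c) : e ∈ Y := by
  have hup : ∀ y ∈ Y, ∃ z ∈ Y, e ≤ z ∧ y ≤ z ∧ minBelow X z = minBelow X e ∪ minBelow X y :=
    fun y hy => by
      obtain ⟨z, hz, h1, h2, h3⟩ := hY.2 c hc y hy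
      exact ⟨z, hz, hec.trans h1, h2, by rw [h3, hmin]⟩
  have hcon : IsConnectedSub X (insert e Y) := by
    constructor
    · rintro y (rfl | hy)
      · rw [hmin]; exact (hY.1 c hc).trans (Set.subset_insert _ _)
      · exact (hY.1 y hy).trans (Set.subset_insert _ _)
    · rintro x (rfl | hx) y (rfl | hy)
      · exact ⟨_, Set.mem_insert _ _, le_rfl, le_rfl, (Set.union_self _).symm⟩
      · obtain ⟨z, hz, h⟩ := hup y hy
        exact ⟨z, Or.inr hz, h⟩
      · obtain ⟨z, hz, h1, h2, h3⟩ := hup x hx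
        exact ⟨z, Or.inr hz, h2, h1, by rw [h3, Set.union_comm]⟩
      · obtain ⟨z, hz, h⟩ := hY.2 x hx y hy
        exact ⟨z, Or.inr hz, h⟩
  rw [hmax _ hcon (Set.subset_insert _ _)]
  exact Set.mem_insert _ _

/-- The unifier from a point onto a minimal element. -/
def pointUnifier {X : Type} [PartialOrder X] [Finite X] (m : X) (hm : ∀ z, z ≤ m → z = m) :
    Unifier X where
  Y := PUnit
  ne := ⟨PUnit.unit⟩
  star _ _ := ⟨PUnit.unit, ⟨fun _ _ => le_rfl, fun _ _ => le_rfl⟩, (Set.union_self _).symm⟩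
  u _ := m
  hu := ⟨fun _ _ _ => le_rfl, fun _ => by
    rw [minBelow_eq_singleton hm, minBelow_eq_singleton fun _ _ => rfl, Set.image_singleton]⟩

/-- Lemma (incomparable min-sets case): the given configuration in a maximal connected
subset forces unification type 0. -/
theorem maximal_connected_incomparable_config_type_zero (X : Type) [PartialOrder X] [Finite X] (Y : Set X)
    (hYcon : IsConnectedSub X Y)
    (hYmax : ∀ Z : Set X, IsConnectedSub X Z → Y ⊆ Z → Y = Z)
    (a b c d : X) (ha : a ∈ Y) (hb : b ∈ Y) (hc : c ∈ Y) (hd : d ∈ Y)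
    (n : ℕ) (hn : 1 ≤ n)
    (h1 : StarCondN' (n - 1) {y : X // y ∈ Y})
    (h2 : (minBelow X a ∪ minBelow X b).ncard = n)
    (h3a : ¬ minBelow X a ⊆ minBelow X b) (h3b : ¬ minBelow X b ⊆ minBelow X a)
    (h4c : minBelow X c = minBelow X a ∪ minBelow X b)
    (h4d : minBelow X d = minBelow X a ∪ minBelow X b)
    (h5 : a ≤ c ∧ a ≤ d ∧ b ≤ c ∧ b ≤ d)
    (h6 : ¬ ∃ e ∈ Y, a ≤ e ∧ b ≤ e ∧ e ≤ c ∧ e ≤ d) :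
    ¬ ∃ M : Set (Unifier X), IsMinimalCompleteSet UnifierLE M := by
  rintro ⟨M, hcomplete, hminimal⟩
  have hno : ¬ ∃ e, a ≤ e ∧ b ≤ e ∧ e ≤ c ∧ e ≤ d := by
    rintro ⟨e, hae, hbe, hec, hed⟩
    refine h6 ⟨e, hYcon.mem_of_maximal hYmax hc hec ?_, hae, hbe, hec, hed⟩
    refine Set.Subset.antisymm (minBelow_subset_of_le hec) ?_
    rw [h4c]
    exact Set.union_subset (minBelow_subset_of_le hae) (minBelow_subset_of_le hbe)
  obtain ⟨l, hl, hlY⟩ := exists_isJoinSystem hYcon ha hb hc hd h1 h2 h3a h3b h4c h4d h5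
  obtain ⟨m, hm⟩ := minBelow_nonempty a
  obtain ⟨v, -, ⟨_, _, r, _, _, _, hr⟩, hv⟩ := hl.exists_fence_unifier hYcon hlY hc hd
    (pointUnifier m hm.2) (fun _ => hYcon.1 a ha hm) 2
  obtain ⟨w, hwM, ψ, -, hψ⟩ := hcomplete v
  have hvw : ∀ y, v.u y ∈ Set.range w.u := fun y => ⟨ψ y, congrFun hψ y⟩
  obtain ⟨w', ⟨φ, hφ, hφu⟩, ⟨_, _, _, hp', hq', hle', hr'⟩, -⟩ :=
    hl.exists_fence_unifier (w.hu.isConnectedSub_range w.star)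
      (fun R α β h => by
        obtain ⟨y, hy⟩ := hv two_pos R α β h
        exact hy ▸ hvw y)
      (by simpa [hr] using hvw (r 0 0)) (by simpa [hr] using hvw (r 1 0)) w
      (fun x => ⟨x, rfl⟩) (Nat.card w.Y + 1)
  obtain ⟨u, huM, χ, hχ, hχu⟩ := hcomplete w'
  have hwu : UnifierLE w u := ⟨χ ∘ φ, ⟨hχ.1.comp hφ.1, fun x => by
    rw [Set.image_comp, hφ.2, hχ.2, Function.comp_apply]⟩, by
    rw [← Function.comp_assoc, hχu, hφu]⟩
  obtain rfl := hminimal w hwM u huM hwu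
  exact not_unifierLE_of_fence hno (Nat.lt_succ_self _) hp' hq' hle' hr' ⟨χ, hχ, hχu⟩
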